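/- Fix an integer p ≥ 2 and τ ∈ ℍ with v := Im τ. For α ∈ 𝒮* define θ₁(α; w₁, w₂) := Σ_{n∈α+ℤ²} (2n₁+n₂) n₂ e^{(3πi/2)(2n₁+n₂)² w₁ + (πi/2) n₂² w₂} and θ₂(α; w₁, w₂) := Σ_{n∈α+ℤ²} (3n₁+2n₂) n₁ e^{(πi/2)(3n₁+2n₂)² w₁ + (3πi/2) n₁² w₂}, and set ℰ_{1,α}(τ) := −(√3/4) ∫_{−τ̄}^{i∞} ∫_{w₁}^{i∞} (θ₁(α; w₁, w₂) + θ₂(α; w₁, w₂)) (−i(w₁+τ))^{−1/2} (−i(w₂+τ))^{−1/2} dw₂ dw₁ (outer path the upward vertical ray from −τ̄, inner path the upward vertical ray from w₁, principal branches). Then Σ_{α∈𝒮*} ε(α) ℰ_{1,α}(τ) = (1/2) Σ_{α∈𝒮*} ε(α) Σ_{n∈α+ℤ²} M₂(√3; √(3v)(2n₁+n₂), √v·n₂) e^{−2πiτ·Q(n)}. -/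

import Mathlib

open Complex MeasureTheory Real Filter Topology

noncomputable section

/-- The quadratic form `Q(x₁,x₂) = 3x₁² + 3x₁x₂ + x₂²`. -/
def Qf (x₁ x₂ : ℝ) : ℝ := 3 * x₁ ^ 2 + 3 * x₁ * x₂ + x₂ ^ 2

/-- `E(u) := 2∫₀ᵘ e^{−πw²} dw`. -/
def Efun (u : ℝ) : ℝ := 2 * ∫ w in (0:ℝ)..u, Real.exp (-Real.pi * w ^ 2)

/-- `M(u) := E(u) − sgn(u)`. -/
def Mfun (u : ℝ) : ℝ := Efun u - Real.sign u

/-- `E₂(κ; u₁, u₂)`. -/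
def E2 (κ u₁ u₂ : ℝ) : ℝ :=
  ∫ w : ℝ × ℝ, Real.sign w.1 * Real.sign (w.2 + κ * w.1) *
    Real.exp (-Real.pi * ((w.1 - u₁) ^ 2 + (w.2 - u₂) ^ 2))

/-- `M₂(κ; u₁, u₂)`. -/
def M2 (κ u₁ u₂ : ℝ) : ℝ :=
  E2 κ u₁ u₂ - Real.sign u₂ * Mfun u₁
    - Real.sign (u₁ - κ * u₂) * Mfun ((u₂ + κ * u₁) / Real.sqrt (1 + κ ^ 2))
    - Real.sign u₁ * Real.sign (u₂ + κ * u₁)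

/-- `θ₁(α; w₁, w₂) = Σ_{n∈α+ℤ²} (2n₁+n₂)n₂ e^{(3πi/2)(2n₁+n₂)²w₁ + (πi/2)n₂²w₂}`. -/
def theta1 (α : ℝ × ℝ) (w₁ w₂ : ℂ) : ℂ :=
  ∑' n : ℤ × ℤ,
    (((2 * (α.1 + n.1) + (α.2 + n.2)) * (α.2 + n.2) : ℝ) : ℂ) *
      Complex.exp ((3 * Real.pi * Complex.I / 2) * (((2 * (α.1 + n.1) + (α.2 + n.2)) ^ 2 : ℝ) : ℂ) * w₁
        + (Real.pi * Complex.I / 2) * ((((α.2 + n.2)) ^ 2 : ℝ) : ℂ) * w₂)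

/-- `θ₂(α; w₁, w₂) = Σ_{n∈α+ℤ²} (3n₁+2n₂)n₁ e^{(πi/2)(3n₁+2n₂)²w₁ + (3πi/2)n₁²w₂}`. -/
def theta2 (α : ℝ × ℝ) (w₁ w₂ : ℂ) : ℂ :=
  ∑' n : ℤ × ℤ,
    (((3 * (α.1 + n.1) + 2 * (α.2 + n.2)) * (α.1 + n.1) : ℝ) : ℂ) *
      Complex.exp ((Real.pi * Complex.I / 2) * (((3 * (α.1 + n.1) + 2 * (α.2 + n.2)) ^ 2 : ℝ) : ℂ) * w₁
        + (3 * Real.pi * Complex.I / 2) * ((((α.1 + n.1)) ^ 2 : ℝ) : ℂ) * w₂)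

/-- The point `−τ̄ + is` on the vertical ray from `−τ̄` to `i∞`. -/
def vray (τ : ℂ) (s : ℝ) : ℂ := -(starRingEnd ℂ) τ + Complex.I * s

/-- `ℰ_{1,α}(τ) = −(√3/4)∫_{−τ̄}^{i∞}∫_{w₁}^{i∞} (θ₁+θ₂)(α;w₁,w₂)
(−i(w₁+τ))^{−1/2}(−i(w₂+τ))^{−1/2} dw₂ dw₁`, with `w₁ = −τ̄+is₁`, `w₂ = w₁+is₂`
(so `dw₂ dw₁ = i·i ds₂ ds₁`). -/
def E1a (α : ℝ × ℝ) (τ : ℂ) : ℂ :=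
  -((Real.sqrt 3 / 4 : ℝ) : ℂ) * (Complex.I * Complex.I *
    ∫ s₁ in Set.Ioi (0:ℝ), ∫ s₂ in Set.Ioi (0:ℝ),
      (theta1 α (vray τ s₁) (vray τ s₁ + Complex.I * s₂)
          + theta2 α (vray τ s₁) (vray τ s₁ + Complex.I * s₂)) *
        (-Complex.I * (vray τ s₁ + τ)) ^ (-(1 : ℂ) / 2) *
        (-Complex.I * (vray τ s₁ + Complex.I * s₂ + τ)) ^ (-(1 : ℂ) / 2))

/-- The set `𝒮*`, listed in order. -/
def Sstar (p : ℕ) : Fin 3 → ℝ × ℝ :=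
  ![(1 - 1 / (p : ℝ), 2 / (p : ℝ)), (0, 1 - 1 / (p : ℝ)), (1 / (p : ℝ), 1 - 1 / (p : ℝ))]

/-- `ε` on `𝒮*`: `−2` on `(1−1/p, 2/p)`, `1` otherwise. -/
def epsStar : Fin 3 → ℝ := ![-2, 1, 1]

theorem measurable_real_sign : Measurable Real.sign :=
  Measurable.ite measurableSet_Iio measurable_const
    (Measurable.ite measurableSet_Ioi measurable_const measurable_const)

theorem abs_real_sign_le_one (x : ℝ) : |Real.sign x| ≤ 1 := by
  rcases Real.sign_apply_eq x with h | h | h <;> simp [h]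

theorem sign_mul_of_pos {s : ℝ} (hs : 0 < s) (x : ℝ) : Real.sign (s * x) = Real.sign x := by
  rcases lt_trichotomy x 0 with h | h | h
  · rw [Real.sign_of_neg h, Real.sign_of_neg (mul_neg_of_pos_of_neg hs h)]
  · simp [h]
  · rw [Real.sign_of_pos h, Real.sign_of_pos (mul_pos hs h)]

theorem integral_sign_mul_of_hasDerivAt {P P' : ℝ → ℝ} {A B : ℝ}
    (hP : ∀ x, HasDerivAt P (P' x) x) (hint : Integrable P')
    (htop : Tendsto P atTop (𝓝 A)) (hbot : Tendsto P atBot (𝓝 B)) :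
    ∫ x, Real.sign x * P' x = A + B - 2 * P 0 := by
  have h1 : ∫ x in Set.Ioi (0:ℝ), Real.sign x * P' x = A - P 0 := by
    rw [← integral_Ioi_of_hasDerivAt_of_tendsto' (fun x _ => hP x) hint.integrableOn htop]
    refine setIntegral_congr_fun measurableSet_Ioi fun x hx => ?_
    simp [Real.sign_of_pos (show 0 < x from hx)]
  have h2 : ∫ x in Set.Iic (0:ℝ), Real.sign x * P' x = -(P 0 - B) := by
    rw [← integral_Iic_of_hasDerivAt_of_tendsto' (fun x _ => hP x) hint.integrableOn hbot,
      ← integral_neg, integral_Iic_eq_integral_Iio, integral_Iic_eq_integral_Iio]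
    refine setIntegral_congr_fun measurableSet_Iio fun x hx => ?_
    simp [Real.sign_of_neg (show x < 0 from hx)]
  have hs : Integrable fun x => Real.sign x * P' x :=
    hint.bdd_mul (c := 1) measurable_real_sign.aestronglyMeasurable
      (ae_of_all _ abs_real_sign_le_one)
  rw [← intervalIntegral.integral_Iic_add_Ioi hs.integrableOn hs.integrableOn, h1, h2]
  ring

theorem integrable_gauss : Integrable fun w : ℝ => Real.exp (-Real.pi * w ^ 2) :=
  integrable_exp_neg_mul_sq Real.pi_pos

theorem integrable_gauss_sub (u : ℝ) :
    Integrable fun w : ℝ => Real.exp (-Real.pi * (w - u) ^ 2) :=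
  integrable_gauss.comp_sub_right u

theorem hasDerivAt_Efun (u : ℝ) : HasDerivAt Efun (2 * Real.exp (-Real.pi * u ^ 2)) u := by
  have hc : Continuous fun w : ℝ => Real.exp (-Real.pi * w ^ 2) := by fun_prop
  exact (intervalIntegral.integral_hasDerivAt_right (hc.intervalIntegrable _ _)
    hc.stronglyMeasurable.stronglyMeasurableAtFilter hc.continuousAt).const_mul 2

theorem continuous_Efun : Continuous Efun :=
  continuous_iff_continuousAt.2 fun u => (hasDerivAt_Efun u).continuousAt

theorem Efun_zero : Efun 0 = 0 := by simp [Efun]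

theorem Efun_neg (u : ℝ) : Efun (-u) = -Efun u := by
  have h := intervalIntegral.integral_comp_neg (a := 0) (b := u)
    (fun w : ℝ => Real.exp (-Real.pi * w ^ 2))
  simp only [neg_sq, neg_zero] at h
  unfold Efun
  rw [h, intervalIntegral.integral_symm (-u) 0]
  ring

theorem tendsto_Efun_atTop : Tendsto Efun atTop (𝓝 1) := by
  have h := (intervalIntegral_tendsto_integral_Ioi 0
    (integrable_gauss.integrableOn) tendsto_id).const_mul (2 : ℝ)
  rw [integral_gaussian_Ioi, div_self Real.pi_ne_zero] at h
  have e : 2 * (Real.sqrt 1 / 2) = 1 := by simp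
  rw [e] at h
  exact h

theorem tendsto_Efun_atBot : Tendsto Efun atBot (𝓝 (-1)) := by
  have h := (tendsto_Efun_atTop.comp tendsto_neg_atBot_atTop).neg
  refine h.congr fun u => ?_
  simp [Efun_neg]

theorem one_sub_Efun (u : ℝ) :
    1 - Efun u = 2 * ∫ w in Set.Ioi u, Real.exp (-Real.pi * w ^ 2) := by
  rw [← integral_Ioi_of_hasDerivAt_of_tendsto' (fun x _ => hasDerivAt_Efun x)
    (integrable_gauss.const_mul 2).integrableOn tendsto_Efun_atTop, integral_const_mul]

theorem Efun_le_one (u : ℝ) : Efun u ≤ 1 := by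
  have h : 0 ≤ ∫ w in Set.Ioi u, Real.exp (-Real.pi * w ^ 2) := by positivity
  linarith [one_sub_Efun u]

theorem abs_Efun_le_one (u : ℝ) : |Efun u| ≤ 1 :=
  abs_le.2 ⟨by linarith [Efun_le_one (-u), Efun_neg u], Efun_le_one u⟩

theorem one_sub_Efun_le {u : ℝ} (hu : 0 ≤ u) : 1 - Efun u ≤ Real.exp (-Real.pi * u ^ 2) := by
  have h0 : ∫ w in Set.Ioi (0 : ℝ), Real.exp (-Real.pi * w ^ 2) = 1 / 2 := by
    rw [integral_gaussian_Ioi, div_self Real.pi_ne_zero]; simp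
  have hs : ∫ w in Set.Ioi u, Real.exp (-Real.pi * w ^ 2)
      = ∫ w in Set.Ioi (0 : ℝ), Real.exp (-Real.pi * (w + u) ^ 2) := by
    rw [← (measurePreserving_add_right volume u).setIntegral_preimage_emb
      (measurableEmbedding_addRight u)]
    simp
  have hle : ∫ w in Set.Ioi (0 : ℝ), Real.exp (-Real.pi * (w + u) ^ 2)
      ≤ ∫ w in Set.Ioi (0 : ℝ), Real.exp (-Real.pi * u ^ 2) * Real.exp (-Real.pi * w ^ 2) := by
    refine setIntegral_mono_on (integrable_gauss.comp_add_right u).integrableOn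
      (integrable_gauss.const_mul _).integrableOn measurableSet_Ioi fun w hw => ?_
    rw [← Real.exp_add]
    refine Real.exp_le_exp.2 ?_
    nlinarith [mul_nonneg Real.pi_pos.le (mul_nonneg (le_of_lt (show 0 < w from hw)) hu)]
  rw [integral_const_mul, h0] at hle
  rw [one_sub_Efun, hs]
  linarith

theorem Mfun_zero : Mfun 0 = 0 := by simp [Mfun, Efun_zero]

theorem Mfun_neg (u : ℝ) : Mfun (-u) = -Mfun u := by
  rw [Mfun, Mfun, Efun_neg, Real.sign_neg]; ring

theorem Mfun_of_pos {u : ℝ} (hu : 0 < u) : Mfun u = Efun u - 1 := by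
  rw [Mfun, Real.sign_of_pos hu]

theorem abs_Mfun_le (u : ℝ) : |Mfun u| ≤ Real.exp (-Real.pi * u ^ 2) := by
  have key : ∀ u : ℝ, 0 < u → |Mfun u| ≤ Real.exp (-Real.pi * u ^ 2) := fun u hu => by
    rw [Mfun_of_pos hu, abs_sub_comm, abs_of_nonneg (by linarith [Efun_le_one u])]
    exact one_sub_Efun_le hu.le
  rcases lt_trichotomy u 0 with h | h | h
  · have := key (-u) (by linarith)
    rwa [Mfun_neg, abs_neg, neg_sq] at this
  · simp [h, Mfun_zero]
  · exact key u h

theorem measurable_Mfun : Measurable Mfun :=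
  continuous_Efun.measurable.sub measurable_real_sign

theorem integral_sign_mul_gauss (y : ℝ) :
    ∫ z, Real.sign z * Real.exp (-Real.pi * (z - y) ^ 2) = Efun y := by
  have hd : ∀ x, HasDerivAt (fun z => Efun (z - y) / 2)
      (Real.exp (-Real.pi * (x - y) ^ 2)) x := fun x => by
    have := ((hasDerivAt_Efun (x - y)).comp_sub_const x y).div_const 2
    simpa using this
  have ht : Tendsto (fun z => Efun (z - y) / 2) atTop (𝓝 (1 / 2)) :=
    (tendsto_Efun_atTop.comp (tendsto_atTop_add_const_right _ (-y) tendsto_id)).div_const 2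
  have hb : Tendsto (fun z => Efun (z - y) / 2) atBot (𝓝 (-1 / 2)) :=
    (tendsto_Efun_atBot.comp (tendsto_atBot_add_const_right _ (-y) tendsto_id)).div_const 2
  rw [integral_sign_mul_of_hasDerivAt hd (integrable_gauss_sub y) ht hb, zero_sub, Efun_neg]
  ring

theorem integral_sign_mul_gauss_scaled {N : ℝ} (hN : 0 < N) (y : ℝ) :
    ∫ z, Real.sign z * Real.exp (-Real.pi * (N * z - y) ^ 2) = Efun y / N := by
  have h := Measure.integral_comp_mul_left
    (fun z => Real.sign z * Real.exp (-Real.pi * (z - y) ^ 2)) N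
  rw [integral_sign_mul_gauss, abs_of_pos (inv_pos.2 hN), smul_eq_mul] at h
  rw [div_eq_inv_mul, ← h]
  refine integral_congr_ae (ae_of_all _ fun z => ?_)
  simp [sign_mul_of_pos hN]

theorem integrable_E2_integrand (κ u₁ u₂ : ℝ) :
    Integrable fun w : ℝ × ℝ => Real.sign w.1 * Real.sign (w.2 + κ * w.1) *
      Real.exp (-Real.pi * ((w.1 - u₁) ^ 2 + (w.2 - u₂) ^ 2)) := by
  have hg : Integrable (fun w : ℝ × ℝ =>
      Real.exp (-Real.pi * ((w.1 - u₁) ^ 2 + (w.2 - u₂) ^ 2))) (volume.prod volume) := by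
    refine ((integrable_gauss_sub u₁).mul_prod (integrable_gauss_sub u₂)).congr
      (ae_of_all _ fun w => ?_)
    simp only [← Real.exp_add]; congr 1; ring
  refine Integrable.bdd_mul (c := 1) hg ?_ (ae_of_all _ fun w => ?_)
  · exact ((measurable_real_sign.comp measurable_fst).mul
      (measurable_real_sign.comp (by fun_prop))).aestronglyMeasurable
  · rw [norm_mul]
    exact mul_le_one₀ (abs_real_sign_le_one _) (norm_nonneg _) (abs_real_sign_le_one _)

theorem E2_eq_integral (κ u₁ u₂ : ℝ) :
    E2 κ u₁ u₂ = ∫ w : ℝ, Real.sign w *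
      (Real.exp (-Real.pi * (w - u₁) ^ 2) * Efun (u₂ + κ * w)) := by
  have h := integrable_E2_integrand κ u₁ u₂
  rw [E2]
  rw [Measure.volume_eq_prod] at h ⊢
  rw [integral_prod _ h]
  refine integral_congr_ae (ae_of_all _ fun w => ?_)
  have hs := integral_add_right_eq_self (μ := (volume : Measure ℝ))
    (fun z => Real.sign z * Real.exp (-Real.pi * (z - (u₂ + κ * w)) ^ 2)) (κ * w)
  rw [integral_sign_mul_gauss] at hs
  simp only
  rw [← hs, ← integral_const_mul, ← integral_const_mul]
  refine integral_congr_ae (ae_of_all _ fun z => ?_)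
  simp only
  rw [show z + κ * w - (u₂ + κ * w) = z - u₂ by ring, mul_add, Real.exp_add]
  ring

theorem abs_mul_gauss_le (z : ℝ) :
    |z| * Real.exp (-Real.pi * z ^ 2) ≤ Real.exp (-(Real.pi / 2) * z ^ 2) := by
  have h : |z| ≤ Real.exp (Real.pi / 2 * z ^ 2) := by
    have h1 := Real.add_one_le_exp (Real.pi / 2 * z ^ 2)
    have h2 := Real.pi_gt_three
    have h3 : 2 * |z| ≤ 1 + z ^ 2 := by nlinarith [sq_nonneg (|z| - 1), sq_abs z]
    nlinarith [sq_nonneg z, abs_nonneg z]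
  calc _ ≤ Real.exp (Real.pi / 2 * z ^ 2) * Real.exp (-Real.pi * z ^ 2) := by gcongr
    _ = _ := by rw [← Real.exp_add]; congr 1; ring

theorem exp_shift_le {w a R : ℝ} (h : |a| ≤ R) :
    Real.exp (-(Real.pi / 2) * (w - a) ^ 2)
      ≤ Real.exp (Real.pi / 2 * R ^ 2) * Real.exp (-(Real.pi / 4) * w ^ 2) := by
  rw [← Real.exp_add]
  refine Real.exp_le_exp.2 ?_
  have h1 : a ^ 2 ≤ R ^ 2 := sq_le_sq.2 (h.trans (le_abs_self R))
  have h2 : w ^ 2 / 2 ≤ (w - a) ^ 2 + R ^ 2 := by nlinarith [sq_nonneg (w - 2 * a)]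
  nlinarith [Real.pi_pos]

theorem hasDerivAt_gauss_sub (w x₁ s : ℝ) :
    HasDerivAt (fun s : ℝ => Real.exp (-Real.pi * (w - s * x₁) ^ 2))
      (2 * Real.pi * x₁ * (w - s * x₁) * Real.exp (-Real.pi * (w - s * x₁) ^ 2)) s := by
  have h := ((((hasDerivAt_id s).mul_const x₁).const_sub w).pow 2).const_mul (-Real.pi) |>.exp
  refine h.congr_deriv ?_
  simp; ring

theorem hasDerivAt_E2_ray_aux (κ x₁ x₂ s : ℝ) :
    Integrable (fun w => Real.sign w *
        (2 * Real.pi * x₁ * (w - s * x₁) * Real.exp (-Real.pi * (w - s * x₁) ^ 2)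
            * Efun (s * x₂ + κ * w)
          + Real.exp (-Real.pi * (w - s * x₁) ^ 2)
            * (2 * x₂ * Real.exp (-Real.pi * (s * x₂ + κ * w) ^ 2)))) ∧
    HasDerivAt (fun s => E2 κ (s * x₁) (s * x₂))
      (∫ w, Real.sign w *
        (2 * Real.pi * x₁ * (w - s * x₁) * Real.exp (-Real.pi * (w - s * x₁) ^ 2)
            * Efun (s * x₂ + κ * w)
          + Real.exp (-Real.pi * (w - s * x₁) ^ 2)
            * (2 * x₂ * Real.exp (-Real.pi * (s * x₂ + κ * w) ^ 2)))) s := by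
  simp_rw [E2_eq_integral]
  have hE := continuous_Efun
  refine hasDerivAt_integral_of_dominated_loc_of_deriv_le
    (F := fun s w => Real.sign w *
      (Real.exp (-Real.pi * (w - s * x₁) ^ 2) * Efun (s * x₂ + κ * w)))
    (F' := fun s w => Real.sign w *
        (2 * Real.pi * x₁ * (w - s * x₁) * Real.exp (-Real.pi * (w - s * x₁) ^ 2)
            * Efun (s * x₂ + κ * w)
          + Real.exp (-Real.pi * (w - s * x₁) ^ 2)
            * (2 * x₂ * Real.exp (-Real.pi * (s * x₂ + κ * w) ^ 2))))
    (bound := fun w => (2 * Real.pi * |x₁| + 2 * |x₂|) *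
      (Real.exp (Real.pi / 2 * ((|s| + 1) * |x₁|) ^ 2) * Real.exp (-(Real.pi / 4) * w ^ 2)))
    (Metric.ball_mem_nhds s one_pos) ?_ ?_ ?_ ?_ ?_ ?_
  · refine Eventually.of_forall fun s => ?_
    exact (measurable_real_sign.mul (by fun_prop : Continuous _).measurable).aestronglyMeasurable
  · refine Integrable.bdd_mul (c := 1) ?_ measurable_real_sign.aestronglyMeasurable
      (ae_of_all _ abs_real_sign_le_one)
    exact (integrable_gauss_sub _).mul_bdd (c := 1)
      (by fun_prop : Continuous _).aestronglyMeasurable (ae_of_all _ fun w => abs_Efun_le_one _)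
  · exact (measurable_real_sign.mul (by fun_prop : Continuous _).measurable).aestronglyMeasurable
  · refine ae_of_all _ fun w y hy => ?_
    have hy' : |y| ≤ |s| + 1 := by
      have h1 : |y - s| < 1 := by simpa [Real.dist_eq] using hy
      have := abs_add_le (y - s) s
      rw [sub_add_cancel] at this
      linarith
    have ha : |y * x₁| ≤ (|s| + 1) * |x₁| := by rw [abs_mul]; gcongr
    refine le_trans ?_ (mul_le_mul_of_nonneg_left (exp_shift_le (w := w) ha) (by positivity))
    have e1 := abs_mul_gauss_le (w - y * x₁)
    have e2 : Real.exp (-Real.pi * (w - y * x₁) ^ 2)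
        ≤ Real.exp (-(Real.pi / 2) * (w - y * x₁) ^ 2) := by
      refine Real.exp_le_exp.2 ?_
      nlinarith [Real.pi_pos, sq_nonneg (w - y * x₁), mul_nonneg Real.pi_pos.le (sq_nonneg (w - y * x₁))]
    have e3 : Real.exp (-Real.pi * (y * x₂ + κ * w) ^ 2) ≤ 1 := by
      refine Real.exp_le_one_iff.2 ?_
      nlinarith [mul_nonneg Real.pi_pos.le (sq_nonneg (y * x₂ + κ * w))]
    rw [norm_mul]
    refine (mul_le_of_le_one_left (norm_nonneg _) (abs_real_sign_le_one w)).trans ?_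
    refine (norm_add_le _ _).trans ?_
    rw [add_mul]
    refine add_le_add ?_ ?_
    · simp only [norm_mul, Real.norm_eq_abs, abs_two, abs_of_pos Real.pi_pos, Real.abs_exp]
      calc 2 * Real.pi * |x₁| * |w - y * x₁| * Real.exp (-Real.pi * (w - y * x₁) ^ 2)
            * |Efun (y * x₂ + κ * w)|
          ≤ 2 * Real.pi * |x₁| * |w - y * x₁| * Real.exp (-Real.pi * (w - y * x₁) ^ 2) * 1 := by
            gcongr; exact abs_Efun_le_one _
        _ = 2 * Real.pi * |x₁| * (|w - y * x₁| * Real.exp (-Real.pi * (w - y * x₁) ^ 2)) := by ring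
        _ ≤ _ := by gcongr
    · simp only [norm_mul, Real.norm_eq_abs, abs_two, Real.abs_exp]
      calc Real.exp (-Real.pi * (w - y * x₁) ^ 2) *
            (2 * |x₂| * Real.exp (-Real.pi * (y * x₂ + κ * w) ^ 2))
          ≤ Real.exp (-(Real.pi / 2) * (w - y * x₁) ^ 2) * (2 * |x₂| * 1) := by gcongr
        _ = _ := by ring
  · exact ((integrable_exp_neg_mul_sq (by positivity)).const_mul _).const_mul _
  · refine ae_of_all _ fun w y _ => ?_
    have h2 : HasDerivAt (fun s => Efun (s * x₂ + κ * w))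
        (2 * Real.exp (-Real.pi * (y * x₂ + κ * w) ^ 2) * x₂) y := by
      have h := (hasDerivAt_Efun (y * x₂ + κ * w)).comp y
        (((hasDerivAt_id y).mul_const x₂).add_const (κ * w))
      simpa [Function.comp_def] using h
    refine (((hasDerivAt_gauss_sub w x₁ y).mul h2).const_mul (Real.sign w)).congr_deriv ?_
    ring

theorem hasDerivAt_E2_ray (κ x₁ x₂ s : ℝ) :
    HasDerivAt (fun s => E2 κ (s * x₁) (s * x₂))
      (2 * x₁ * Real.exp (-Real.pi * (s * x₁) ^ 2) * Efun (s * x₂)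
        + 2 * ((x₂ + κ * x₁) / Real.sqrt (1 + κ ^ 2))
          * Real.exp (-Real.pi * (s * ((x₂ + κ * x₁) / Real.sqrt (1 + κ ^ 2))) ^ 2)
          * Efun (s * ((x₁ - κ * x₂) / Real.sqrt (1 + κ ^ 2)))) s := by
  obtain ⟨hint, hder⟩ := hasDerivAt_E2_ray_aux κ x₁ x₂ s
  refine hder.congr_deriv ?_
  set N := Real.sqrt (1 + κ ^ 2) with hN
  have hN0 : 0 < N := Real.sqrt_pos.2 (by positivity)
  have hN2 : N ^ 2 = 1 + κ ^ 2 := Real.sq_sqrt (by positivity)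
  -- the product whose derivative produces the boundary term
  set P : ℝ → ℝ := fun w => Real.exp (-Real.pi * (w - s * x₁) ^ 2) * Efun (s * x₂ + κ * w) with hP
  set G : ℝ → ℝ := fun w => Real.exp (-Real.pi * (w - s * x₁) ^ 2)
    * Real.exp (-Real.pi * (s * x₂ + κ * w) ^ 2) with hG
  set P' : ℝ → ℝ := fun w => -(2 * Real.pi * (w - s * x₁)
      * Real.exp (-Real.pi * (w - s * x₁) ^ 2) * Efun (s * x₂ + κ * w)) + 2 * κ * G w with hP'
  have hE := continuous_Efun
  have hPd : ∀ w, HasDerivAt P (P' w) w := fun w => by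
    have h1 : HasDerivAt (fun w : ℝ => Real.exp (-Real.pi * (w - s * x₁) ^ 2))
        (-(2 * Real.pi * (w - s * x₁) * Real.exp (-Real.pi * (w - s * x₁) ^ 2))) w := by
      refine ((((hasDerivAt_id w).sub_const (s * x₁)).pow 2).const_mul
        (-Real.pi)).exp.congr_deriv ?_
      simp; ring
    have h2 : HasDerivAt (fun w => Efun (s * x₂ + κ * w))
        (2 * Real.exp (-Real.pi * (s * x₂ + κ * w) ^ 2) * κ) w := by
      have h := (hasDerivAt_Efun (s * x₂ + κ * w)).comp w
        (((hasDerivAt_id w).const_mul κ).const_add (s * x₂))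
      simpa [Function.comp_def] using h
    refine (h1.mul h2).congr_deriv ?_
    simp only [hP', hG]; ring
  have hGle : ∀ w, |Real.exp (-Real.pi * (s * x₂ + κ * w) ^ 2)| ≤ 1 := fun w => by
    rw [Real.abs_exp]
    refine Real.exp_le_one_iff.2 ?_
    nlinarith [mul_nonneg Real.pi_pos.le (sq_nonneg (s * x₂ + κ * w))]
  have hGint : Integrable G := (integrable_gauss_sub _).mul_bdd (c := 1)
    (by fun_prop : Continuous _).aestronglyMeasurable (ae_of_all _ hGle)
  have hzint : Integrable fun w : ℝ => (w - s * x₁) * Real.exp (-Real.pi * (w - s * x₁) ^ 2) :=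
    (integrable_mul_exp_neg_mul_sq Real.pi_pos).comp_sub_right (s * x₁)
  have hP'int : Integrable P' := by
    refine Integrable.add ?_ (hGint.const_mul _)
    have h1 : Integrable fun w : ℝ =>
        ((w - s * x₁) * Real.exp (-Real.pi * (w - s * x₁) ^ 2)) * Efun (s * x₂ + κ * w) :=
      hzint.mul_bdd (c := 1) (by fun_prop : Continuous _).aestronglyMeasurable
        (ae_of_all _ fun w => abs_Efun_le_one _)
    refine (h1.const_mul (-(2 * Real.pi))).congr (ae_of_all _ fun w => ?_)
    simp only; ring
  have hPint : Integrable P := (integrable_gauss_sub _).mul_bdd (c := 1)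
    (by fun_prop : Continuous _).aestronglyMeasurable (ae_of_all _ fun w => abs_Efun_le_one _)
  have ht : Tendsto P atTop (𝓝 0) := tendsto_zero_of_hasDerivAt_of_integrableOn_Ioi (a := 0)
    (fun x _ => hPd x) hP'int.integrableOn hPint.integrableOn
  have hb : Tendsto P atBot (𝓝 0) := tendsto_zero_of_hasDerivAt_of_integrableOn_Iic (a := 0)
    (fun x _ => hPd x) hP'int.integrableOn hPint.integrableOn
  have hsP := integral_sign_mul_of_hasDerivAt hPd hP'int ht hb
  have hsG : ∫ w, Real.sign w * G w = Real.exp (-Real.pi * (s * ((x₂ + κ * x₁) / N)) ^ 2)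
      * (Efun (s * ((x₁ - κ * x₂) / N)) / N) := by
    rw [← integral_sign_mul_gauss_scaled hN0, ← integral_const_mul]
    refine integral_congr_ae (ae_of_all _ fun w => ?_)
    have e : -Real.pi * (w - s * x₁) ^ 2 + -Real.pi * (s * x₂ + κ * w) ^ 2
        = -Real.pi * (s * ((x₂ + κ * x₁) / N)) ^ 2
          + -Real.pi * (N * w - s * ((x₁ - κ * x₂) / N)) ^ 2 := by
      field_simp
      rw [hN2]; ring
    simp only [hG]
    rw [← Real.exp_add, e, Real.exp_add]; ring
  have hsplit : ∀ w, Real.sign w *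
        (2 * Real.pi * x₁ * (w - s * x₁) * Real.exp (-Real.pi * (w - s * x₁) ^ 2)
            * Efun (s * x₂ + κ * w)
          + Real.exp (-Real.pi * (w - s * x₁) ^ 2)
            * (2 * x₂ * Real.exp (-Real.pi * (s * x₂ + κ * w) ^ 2)))
      = -x₁ * (Real.sign w * P' w) + 2 * (x₂ + κ * x₁) * (Real.sign w * G w) := fun w => by
    simp only [hP', hG]; ring
  have hb1 : ∀ f : ℝ → ℝ, Integrable f → Integrable fun w => Real.sign w * f w := fun f hf =>
    hf.bdd_mul (c := 1) measurable_real_sign.aestronglyMeasurable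
      (ae_of_all _ abs_real_sign_le_one)
  simp_rw [hsplit]
  rw [integral_add ((hb1 _ hP'int).const_mul _) ((hb1 _ hGint).const_mul _),
    integral_const_mul, integral_const_mul, hsP, hsG]
  simp only [hP]
  rw [zero_sub, neg_sq, mul_zero κ, add_zero (s * x₂)]
  ring

theorem hasDerivAt_Mfun_ray (x : ℝ) {s : ℝ} (hs : 0 < s) :
    HasDerivAt (fun s => Mfun (s * x)) (2 * x * Real.exp (-Real.pi * (s * x) ^ 2)) s := by
  have h : HasDerivAt (fun s => Efun (s * x) - Real.sign x)
      (2 * x * Real.exp (-Real.pi * (s * x) ^ 2)) s := by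
    refine (((hasDerivAt_Efun (s * x)).comp s
      ((hasDerivAt_id s).mul_const x)).sub_const _).congr_deriv ?_
    ring
  refine h.congr_of_eventuallyEq ?_
  filter_upwards [lt_mem_nhds hs] with r hr
  rw [Mfun, sign_mul_of_pos hr]

theorem tendsto_Mfun_ray (x : ℝ) : Tendsto (fun s => Mfun (s * x)) atTop (𝓝 0) := by
  rcases eq_or_ne x 0 with rfl | hx
  · simp [Mfun_zero]
  have hx2 : 0 < Real.pi * x ^ 2 := by positivity
  have h1 : Tendsto (fun s : ℝ => Real.exp (-Real.pi * (s * x) ^ 2)) atTop (𝓝 0) := by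
    refine Real.tendsto_exp_atBot.comp ?_
    have h2 : Tendsto (fun s : ℝ => Real.pi * x ^ 2 * s ^ 2) atTop atTop :=
      (tendsto_pow_atTop two_ne_zero).const_mul_atTop hx2
    refine (tendsto_neg_atTop_atBot.comp h2).congr fun s => ?_
    simp only [Function.comp]; ring
  exact squeeze_zero_norm (fun s => abs_Mfun_le _) h1

theorem M2_ray (κ x₁ x₂ : ℝ) {s : ℝ} (hs : 0 < s) :
    M2 κ (s * x₁) (s * x₂) = E2 κ (s * x₁) (s * x₂) - Real.sign x₂ * Mfun (s * x₁)
      - Real.sign (x₁ - κ * x₂) * Mfun (s * ((x₂ + κ * x₁) / Real.sqrt (1 + κ ^ 2)))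
      - Real.sign x₁ * Real.sign (x₂ + κ * x₁) := by
  rw [M2, show s * x₁ - κ * (s * x₂) = s * (x₁ - κ * x₂) by ring,
    show s * x₂ + κ * (s * x₁) = s * (x₂ + κ * x₁) by ring, sign_mul_of_pos hs,
    sign_mul_of_pos hs, sign_mul_of_pos hs, sign_mul_of_pos hs, mul_div_assoc]

theorem hasDerivAt_M2_ray (κ x₁ x₂ : ℝ) {s : ℝ} (hs : 0 < s) :
    HasDerivAt (fun s => M2 κ (s * x₁) (s * x₂))
      (2 * x₁ * Real.exp (-Real.pi * (s * x₁) ^ 2) * Mfun (s * x₂)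
        + 2 * ((x₂ + κ * x₁) / Real.sqrt (1 + κ ^ 2))
          * Real.exp (-Real.pi * (s * ((x₂ + κ * x₁) / Real.sqrt (1 + κ ^ 2))) ^ 2)
          * Mfun (s * ((x₁ - κ * x₂) / Real.sqrt (1 + κ ^ 2)))) s := by
  have hN0 : 0 < Real.sqrt (1 + κ ^ 2) := Real.sqrt_pos.2 (by positivity)
  have h := (((hasDerivAt_E2_ray κ x₁ x₂ s).sub
    ((hasDerivAt_Mfun_ray x₁ hs).const_mul (Real.sign x₂))).sub
    ((hasDerivAt_Mfun_ray ((x₂ + κ * x₁) / Real.sqrt (1 + κ ^ 2)) hs).const_mul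
      (Real.sign (x₁ - κ * x₂)))).sub_const (Real.sign x₁ * Real.sign (x₂ + κ * x₁))
  refine (h.congr_of_eventuallyEq ?_).congr_deriv ?_
  · filter_upwards [lt_mem_nhds hs] with r hr
    rw [M2_ray κ x₁ x₂ hr]; rfl
  · have e : Real.sign ((x₁ - κ * x₂) / Real.sqrt (1 + κ ^ 2)) = Real.sign (x₁ - κ * x₂) := by
      rw [div_eq_inv_mul, sign_mul_of_pos (inv_pos.2 hN0)]
    rw [Mfun, Mfun, sign_mul_of_pos hs, sign_mul_of_pos hs, e]
    ring

theorem sign_mul_add_eventually {x : ℝ} (hx : x ≠ 0) (c : ℝ) :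
    ∀ᶠ s : ℝ in atTop, Real.sign (c + s * x) = Real.sign x := by
  rcases lt_or_gt_of_ne hx with h | h
  · have : Tendsto (fun s : ℝ => c + s * x) atTop atBot :=
      tendsto_atBot_add_const_left _ c (tendsto_id.atTop_mul_const_of_neg h)
    filter_upwards [this.eventually (eventually_lt_atBot 0)] with s hs
    rw [Real.sign_of_neg h, Real.sign_of_neg hs]
  · have : Tendsto (fun s : ℝ => c + s * x) atTop atTop :=
      tendsto_atTop_add_const_left _ c (tendsto_id.atTop_mul_const h)
    filter_upwards [this.eventually (eventually_gt_atTop 0)] with s hs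
    rw [Real.sign_of_pos h, Real.sign_of_pos hs]

theorem integrable_gauss_prod :
    Integrable fun z : ℝ × ℝ => Real.exp (-Real.pi * (z.1 ^ 2 + z.2 ^ 2)) := by
  refine (integrable_gauss.mul_prod integrable_gauss).congr (ae_of_all _ fun w => ?_)
  simp only [← Real.exp_add]; congr 1; ring

theorem integral_gauss_prod :
    ∫ z : ℝ × ℝ, Real.exp (-Real.pi * (z.1 ^ 2 + z.2 ^ 2)) = 1 := by
  have h1 : ∫ x : ℝ, Real.exp (-Real.pi * x ^ 2) = 1 := by
    rw [integral_gaussian, div_self Real.pi_ne_zero, Real.sqrt_one]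
  have h := integral_prod_mul (μ := (volume : Measure ℝ)) (ν := (volume : Measure ℝ))
    (fun x : ℝ => Real.exp (-Real.pi * x ^ 2)) (fun x : ℝ => Real.exp (-Real.pi * x ^ 2))
  rw [h1, one_mul] at h
  rw [← h, Measure.volume_eq_prod]
  refine integral_congr_ae (ae_of_all _ fun w => ?_)
  simp only [← Real.exp_add]; congr 1; ring

theorem integral_eq_zero_of_odd {f : ℝ × ℝ → ℝ} (hf : ∀ z, f (-z) = -f z) : ∫ z, f z = 0 := by
  have h := integral_neg_eq_self f (volume : Measure (ℝ × ℝ))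
  simp_rw [hf] at h
  rw [integral_neg] at h
  linarith

theorem tendsto_E2_ray (κ : ℝ) {x₁ x₂ : ℝ} (hx : x₁ ≠ 0 ∨ x₂ ≠ 0) :
    Tendsto (fun s => E2 κ (s * x₁) (s * x₂)) atTop
      (𝓝 (Real.sign x₁ * Real.sign (x₂ + κ * x₁))) := by
  -- pointwise limit of the sign of `c + s * x`
  set ℓ : ℝ → ℝ → ℝ := fun x c => if x = 0 then Real.sign c else Real.sign x with hℓ
  have hℓt : ∀ x c, Tendsto (fun s : ℝ => Real.sign (c + s * x)) atTop (𝓝 (ℓ x c)) := by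
    intro x c
    by_cases h : x = 0
    · simp [hℓ, h]
    · simp only [hℓ, h, if_false]
      exact tendsto_const_nhds.congr' ((sign_mul_add_eventually h c).mono fun s hs => hs.symm)
  set y := x₂ + κ * x₁ with hy
  have hE : ∀ s, E2 κ (s * x₁) (s * x₂) = ∫ z : ℝ × ℝ, Real.sign (z.1 + s * x₁) *
      Real.sign (z.2 + κ * z.1 + s * y) * Real.exp (-Real.pi * (z.1 ^ 2 + z.2 ^ 2)) := fun s => by
    rw [E2, ← integral_add_right_eq_self _ ((s * x₁, s * x₂) : ℝ × ℝ)]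
    refine integral_congr_ae (ae_of_all _ fun z => ?_)
    simp only [Prod.fst_add, Prod.snd_add, add_sub_cancel_right, hy]
    rw [show z.2 + s * x₂ + κ * (z.1 + s * x₁) = z.2 + κ * z.1 + s * (x₂ + κ * x₁) by ring]
  have hlim : Tendsto (fun s => E2 κ (s * x₁) (s * x₂)) atTop (𝓝 (∫ z : ℝ × ℝ,
      ℓ x₁ z.1 * ℓ y (z.2 + κ * z.1) * Real.exp (-Real.pi * (z.1 ^ 2 + z.2 ^ 2)))) := by
    simp_rw [hE]
    refine tendsto_integral_filter_of_dominated_convergence _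
      (Eventually.of_forall fun s => ?_) (Eventually.of_forall fun s => ae_of_all _ fun z => ?_)
      integrable_gauss_prod (ae_of_all _ fun z => ?_)
    · exact (((measurable_real_sign.comp (by fun_prop)).mul
        (measurable_real_sign.comp (by fun_prop))).mul
        (by fun_prop : Continuous _).measurable).aestronglyMeasurable
    · rw [norm_mul, norm_mul, Real.norm_eq_abs (Real.exp _), Real.abs_exp]
      exact mul_le_of_le_one_left (Real.exp_pos _).le
        (mul_le_one₀ (abs_real_sign_le_one _) (norm_nonneg _) (abs_real_sign_le_one _))
    · exact ((hℓt _ _).mul (hℓt _ _)).mul_const _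
  convert hlim using 2
  by_cases h1 : x₁ = 0
  · have h2 : x₂ ≠ 0 := by simpa [h1] using hx
    have hy0 : y ≠ 0 := by simpa [hy, h1] using h2
    rw [h1, Real.sign_zero, zero_mul]
    symm
    refine integral_eq_zero_of_odd fun z => ?_
    simp [hℓ, hy0, Real.sign_neg]
  by_cases hy0 : y = 0
  · rw [hy0, Real.sign_zero, mul_zero]
    symm
    refine integral_eq_zero_of_odd fun z => ?_
    have hz : (-z).2 + κ * (-z).1 = -(z.2 + κ * z.1) := by simp only [Prod.fst_neg, Prod.snd_neg]; ring
    simp only [hℓ, h1, if_true, if_false]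
    rw [hz, Real.sign_neg]
    simp
  · simp only [hℓ, h1, hy0, if_false]
    rw [integral_const_mul, integral_gauss_prod, mul_one]

theorem tendsto_M2_ray (κ : ℝ) {x₁ x₂ : ℝ} (hx : x₁ ≠ 0 ∨ x₂ ≠ 0) :
    Tendsto (fun s => M2 κ (s * x₁) (s * x₂)) atTop (𝓝 0) := by
  have h := (((tendsto_E2_ray κ hx).sub ((tendsto_Mfun_ray x₁).const_mul (Real.sign x₂))).sub
    ((tendsto_Mfun_ray ((x₂ + κ * x₁) / Real.sqrt (1 + κ ^ 2))).const_mul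
      (Real.sign (x₁ - κ * x₂)))).sub_const (Real.sign x₁ * Real.sign (x₂ + κ * x₁))
  simp only [mul_zero, sub_zero, sub_self] at h
  refine h.congr' ?_
  filter_upwards [eventually_gt_atTop 0] with s hs
  rw [M2_ray κ x₁ x₂ hs]

/-- The integrand `x e^{-π x² t / 2} t^{-1/2}` of a one-dimensional Eichler integral. -/
def eichlerKernel (x t : ℝ) : ℝ := x * Real.exp (-(Real.pi / 2) * x ^ 2 * t) / Real.sqrt t

/-- The tail `∫_T^∞ x e^{-π x² t / 2} t^{-1/2} dt`, in closed form. -/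
def eichlerTail (x T : ℝ) : ℝ := -(Real.sqrt 2 * Mfun (Real.sqrt (T / 2) * x))

theorem hasDerivAt_sqrt_half {t : ℝ} (ht : 0 < t) :
    HasDerivAt (fun t => Real.sqrt (t / 2)) (1 / (2 * Real.sqrt 2 * Real.sqrt t)) t := by
  have h := (Real.hasDerivAt_sqrt ht.ne').div_const (Real.sqrt 2)
  refine (h.congr_of_eventuallyEq ?_).congr_deriv ?_
  · filter_upwards [lt_mem_nhds ht] with r hr
    rw [Real.sqrt_div hr.le]
  · rw [div_div]; ring_nf

theorem exp_ray_eq (x : ℝ) {t : ℝ} (ht : 0 < t) :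
    Real.exp (-Real.pi * (Real.sqrt (t / 2) * x) ^ 2) = Real.exp (-(Real.pi / 2) * x ^ 2 * t) := by
  rw [mul_pow, Real.sq_sqrt (by positivity)]
  congr 1; ring

theorem tendsto_sqrt_half : Tendsto (fun t : ℝ => Real.sqrt (t / 2)) atTop atTop :=
  Real.tendsto_sqrt_atTop.comp (tendsto_id.atTop_div_const two_pos)

theorem hasDerivAt_eichlerTail (x : ℝ) {t : ℝ} (ht : 0 < t) :
    HasDerivAt (eichlerTail x) (-eichlerKernel x t) t := by
  have h := (((hasDerivAt_Mfun_ray x (Real.sqrt_pos.2 (half_pos ht))).comp t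
    (hasDerivAt_sqrt_half ht)).const_mul (Real.sqrt 2)).neg
  refine h.congr_deriv ?_
  rw [exp_ray_eq x ht, eichlerKernel]
  have := Real.sqrt_pos.2 ht
  field_simp

theorem tendsto_eichlerTail (x : ℝ) : Tendsto (eichlerTail x) atTop (𝓝 0) := by
  have h := (((tendsto_Mfun_ray x).comp tendsto_sqrt_half).const_mul (Real.sqrt 2)).neg
  rw [mul_zero, neg_zero] at h
  exact h

theorem abs_eichlerKernel (x t : ℝ) : |eichlerKernel x t| = eichlerKernel |x| t := by
  simp [eichlerKernel, abs_div, abs_mul, abs_of_nonneg (Real.sqrt_nonneg t)]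

theorem eichlerKernel_abs_nonneg (x t : ℝ) : 0 ≤ eichlerKernel |x| t := by
  rw [← abs_eichlerKernel]; positivity

theorem measurable_eichlerKernel (x : ℝ) : Measurable (eichlerKernel x) := by
  unfold eichlerKernel; fun_prop

theorem measurable_eichlerTail (x : ℝ) : Measurable (eichlerTail x) :=
  ((measurable_Mfun.comp (by fun_prop)).const_mul _).neg

theorem integrableOn_eichlerKernel (x : ℝ) {T : ℝ} (hT : 0 < T) :
    IntegrableOn (eichlerKernel x) (Set.Ioi T) := by
  have h := integrableOn_Ioi_deriv_of_nonpos' (a := T)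
    (fun t ht => hasDerivAt_eichlerTail |x| (lt_of_lt_of_le hT ht))
    (fun t _ => neg_nonpos.2 (eichlerKernel_abs_nonneg x t)) (tendsto_eichlerTail |x|)
  refine Integrable.mono h (measurable_eichlerKernel x).aestronglyMeasurable
    (ae_of_all _ fun t => ?_)
  rw [norm_neg, Real.norm_eq_abs, Real.norm_eq_abs, abs_eichlerKernel]
  exact le_abs_self _

theorem integral_eichlerKernel (x : ℝ) {T : ℝ} (hT : 0 < T) :
    ∫ t in Set.Ioi T, eichlerKernel x t = eichlerTail x T := by
  have h := integral_Ioi_of_hasDerivAt_of_tendsto' (a := T)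
    (fun t ht => hasDerivAt_eichlerTail x (lt_of_lt_of_le hT ht))
    (integrableOn_eichlerKernel x hT).neg (tendsto_eichlerTail x)
  simp only [integral_neg] at h
  linarith

theorem abs_eichlerTail_le (x : ℝ) {T : ℝ} (hT : 0 < T) :
    |eichlerTail x T| ≤ 2 * Real.exp (-(Real.pi / 2) * x ^ 2 * T) := by
  rw [eichlerTail, abs_neg, abs_mul, abs_of_nonneg (Real.sqrt_nonneg _), ← exp_ray_eq x hT]
  refine mul_le_mul ?_ (abs_Mfun_le _) (abs_nonneg _) zero_le_two
  rw [Real.sqrt_le_left zero_le_two]; norm_num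

theorem integral_abs_eichlerKernel_le (x : ℝ) {T : ℝ} (hT : 0 < T) :
    ∫ t in Set.Ioi T, |eichlerKernel x t| ≤ 2 * Real.exp (-(Real.pi / 2) * x ^ 2 * T) := by
  simp_rw [abs_eichlerKernel]
  rw [integral_eichlerKernel _ hT]
  refine (le_abs_self _).trans ((abs_eichlerTail_le _ hT).trans ?_)
  rw [sq_abs]

theorem abs_eichlerTail_le_two (x : ℝ) {T : ℝ} (hT : 0 < T) : |eichlerTail x T| ≤ 2 := by
  refine (abs_eichlerTail_le x hT).trans ?_
  have : Real.exp (-(Real.pi / 2) * x ^ 2 * T) ≤ 1 := by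
    rw [Real.exp_le_one_iff]
    have : 0 ≤ Real.pi / 2 * x ^ 2 * T := by positivity
    linarith
  linarith

theorem integrableOn_eichlerKernel_mul_tail (x y : ℝ) {T : ℝ} (hT : 0 < T) :
    IntegrableOn (fun t => eichlerKernel x t * eichlerTail y t) (Set.Ioi T) := by
  refine Integrable.mul_bdd (c := 2) (integrableOn_eichlerKernel x hT)
    (measurable_eichlerTail y).aestronglyMeasurable ?_
  filter_upwards [ae_restrict_mem measurableSet_Ioi] with t ht
  exact abs_eichlerTail_le_two y (hT.trans ht)

theorem integral_eichlerKernel_mul_tail (κ : ℝ) {x₁ x₂ : ℝ} (hx : x₁ ≠ 0 ∨ x₂ ≠ 0) {v : ℝ}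
    (hv : 0 < v) :
    ∫ t in Set.Ioi (2 * v), (eichlerKernel x₁ t * eichlerTail x₂ t
      + eichlerKernel ((x₂ + κ * x₁) / Real.sqrt (1 + κ ^ 2)) t
        * eichlerTail ((x₁ - κ * x₂) / Real.sqrt (1 + κ ^ 2)) t)
      = 2 * M2 κ (Real.sqrt v * x₁) (Real.sqrt v * x₂) := by
  have h2v : 0 < 2 * v := by positivity
  have hs2 : Real.sqrt 2 * Real.sqrt 2 = 2 := Real.mul_self_sqrt zero_le_two
  have hd : ∀ t ∈ Set.Ici (2 * v), HasDerivAt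
      (fun t => -2 * M2 κ (Real.sqrt (t / 2) * x₁) (Real.sqrt (t / 2) * x₂))
      (eichlerKernel x₁ t * eichlerTail x₂ t
      + eichlerKernel ((x₂ + κ * x₁) / Real.sqrt (1 + κ ^ 2)) t
        * eichlerTail ((x₁ - κ * x₂) / Real.sqrt (1 + κ ^ 2)) t) t := fun t ht => by
    have ht0 : 0 < t := lt_of_lt_of_le h2v ht
    have h := ((hasDerivAt_M2_ray κ x₁ x₂ (Real.sqrt_pos.2 (half_pos ht0))).comp t
      (hasDerivAt_sqrt_half ht0)).const_mul (-2)
    refine h.congr_deriv ?_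
    rw [exp_ray_eq _ ht0, exp_ray_eq _ ht0]
    simp only [eichlerKernel, eichlerTail]
    generalize Real.exp (-(Real.pi / 2) * x₁ ^ 2 * t) = e₁
    generalize Real.exp (-(Real.pi / 2) * ((x₂ + κ * x₁) / Real.sqrt (1 + κ ^ 2)) ^ 2 * t) = e₂
    generalize Mfun (Real.sqrt (t / 2) * x₂) = m₁
    generalize Mfun (Real.sqrt (t / 2) * ((x₁ - κ * x₂) / Real.sqrt (1 + κ ^ 2))) = m₂
    generalize (x₂ + κ * x₁) / Real.sqrt (1 + κ ^ 2) = y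
    have hst := Real.sqrt_pos.2 ht0
    have hs := Real.sqrt_pos.2 (zero_lt_two' ℝ)
    field_simp
    rw [Real.sq_sqrt zero_le_two]
    ring
  have ht : Tendsto (fun t => -2 * M2 κ (Real.sqrt (t / 2) * x₁) (Real.sqrt (t / 2) * x₂)) atTop
      (𝓝 0) := by
    have := ((tendsto_M2_ray κ hx).comp tendsto_sqrt_half).const_mul (-2)
    simpa using! this
  rw [integral_Ioi_of_hasDerivAt_of_tendsto' hd ((integrableOn_eichlerKernel_mul_tail _ _ h2v).add
    (integrableOn_eichlerKernel_mul_tail _ _ h2v)) ht, mul_div_cancel_left₀ v two_ne_zero]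
  ring

theorem abs_eichlerKernel_le {x T t : ℝ} (hT : 0 < T) (ht : T ≤ t) :
    |eichlerKernel x t| ≤ |x| / Real.sqrt T * Real.exp (-(Real.pi / 2) * x ^ 2 * T) := by
  have hsT := Real.sqrt_pos.2 hT
  rw [abs_eichlerKernel, eichlerKernel, sq_abs, mul_div_right_comm]
  have : 0 ≤ Real.pi / 2 * x ^ 2 := by positivity
  refine mul_le_mul (by gcongr) (Real.exp_le_exp.2 (by nlinarith)) (Real.exp_pos _).le
    (by positivity)

theorem abs_le_one_add_sq_add_sq (x y : ℝ) : |x| ≤ 1 + (x ^ 2 + y ^ 2) := by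
  nlinarith [sq_nonneg (|x| - 1), sq_abs x, sq_nonneg y, sq_nonneg x]

theorem integral_abs_kernel_mul_kernel_le (x y : ℝ) {T t₁ : ℝ} (hT : 0 < T) (ht : T ≤ t₁) :
    ∫ t in Set.Ioi t₁, |eichlerKernel x t₁ * eichlerKernel y t|
      ≤ 2 / Real.sqrt T * ((1 + (x ^ 2 + y ^ 2)) * Real.exp (-(Real.pi / 2) * (x ^ 2 + y ^ 2) * T)) := by
  have hsT := Real.sqrt_pos.2 hT
  simp_rw [abs_mul]
  rw [integral_const_mul]
  have h1 : ∫ t in Set.Ioi t₁, |eichlerKernel y t| ≤ 2 * Real.exp (-(Real.pi / 2) * y ^ 2 * T) := by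
    refine (integral_abs_eichlerKernel_le y (hT.trans_le ht)).trans ?_
    gcongr 2 * Real.exp ?_
    have : 0 ≤ Real.pi / 2 * y ^ 2 := by positivity
    nlinarith
  calc _ ≤ (|x| / Real.sqrt T * Real.exp (-(Real.pi / 2) * x ^ 2 * T))
        * (2 * Real.exp (-(Real.pi / 2) * y ^ 2 * T)) :=
        mul_le_mul (abs_eichlerKernel_le hT ht) h1 (by positivity) (by positivity)
    _ = 2 / Real.sqrt T * (|x| * Real.exp (-(Real.pi / 2) * (x ^ 2 + y ^ 2) * T)) := by
        rw [show -(Real.pi / 2) * (x ^ 2 + y ^ 2) * T = -(Real.pi / 2) * x ^ 2 * T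
          + -(Real.pi / 2) * y ^ 2 * T by ring, Real.exp_add]
        ring
    _ ≤ _ := by gcongr; exact abs_le_one_add_sq_add_sq x y

theorem integral_abs_kernel_mul_tail_le (x y : ℝ) {T : ℝ} (hT : 0 < T) :
    ∫ t in Set.Ioi T, |eichlerKernel x t * eichlerTail y t|
      ≤ 4 * ((1 + (x ^ 2 + y ^ 2)) * Real.exp (-(Real.pi / 2) * (x ^ 2 + y ^ 2) * T)) := by
  have h1 : ∫ t in Set.Ioi T, |eichlerKernel x t * eichlerTail y t|
      ≤ ∫ t in Set.Ioi T, |eichlerKernel x t| * (2 * Real.exp (-(Real.pi / 2) * y ^ 2 * T)) := by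
    refine setIntegral_mono_on (integrableOn_eichlerKernel_mul_tail x y hT).abs
      ((integrableOn_eichlerKernel x hT).abs.mul_const _) measurableSet_Ioi fun t ht => ?_
    rw [abs_mul]
    have ht' : T < t := ht
    gcongr
    refine (abs_eichlerTail_le y (hT.trans ht)).trans ?_
    gcongr 2 * Real.exp ?_
    have : 0 ≤ Real.pi / 2 * y ^ 2 := by positivity
    nlinarith
  rw [integral_mul_const] at h1
  refine h1.trans ?_
  calc _ ≤ (2 * Real.exp (-(Real.pi / 2) * x ^ 2 * T))
        * (2 * Real.exp (-(Real.pi / 2) * y ^ 2 * T)) := by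
        gcongr; exact integral_abs_eichlerKernel_le x hT
    _ = 4 * (1 * Real.exp (-(Real.pi / 2) * (x ^ 2 + y ^ 2) * T)) := by
        rw [show -(Real.pi / 2) * (x ^ 2 + y ^ 2) * T = -(Real.pi / 2) * x ^ 2 * T
          + -(Real.pi / 2) * y ^ 2 * T by ring, Real.exp_add]
        ring
    _ ≤ _ := by
        gcongr
        nlinarith [sq_nonneg x, sq_nonneg y]

theorem integral_norm_const_mul_add_le {S : Set ℝ} {f g : ℝ → ℝ} (C : ℂ) {B : ℝ}
    (hf : IntegrableOn f S) (hg : IntegrableOn g S)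
    (hfB : ∫ t in S, |f t| ≤ B) (hgB : ∫ t in S, |g t| ≤ B) :
    ∫ t in S, ‖C * ((f t + g t : ℝ) : ℂ)‖ ≤ ‖C‖ * (2 * B) := by
  have h : ∫ t in S, ‖C * ((f t + g t : ℝ) : ℂ)‖ ≤ ∫ t in S, ‖C‖ * (|f t| + |g t|) := by
    refine integral_mono ((hf.add hg).ofReal.const_mul C).norm
      ((hf.abs.add hg.abs).const_mul _) fun t => ?_
    simp only
    rw [norm_mul, Complex.norm_real]
    gcongr
    exact abs_add_le _ _
  refine h.trans ?_
  rw [integral_const_mul, integral_add hf.abs hg.abs]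
  gcongr
  linarith

theorem integral_integral_tsum_eichlerKernel {ι : Type*} [Countable ι] (C : ι → ℂ)
    (x y x' y' r : ι → ℝ) (hr : ∀ n, x n ^ 2 + y n ^ 2 = r n)
    (hr' : ∀ n, x' n ^ 2 + y' n ^ 2 = r n) {T : ℝ} (hT : 0 < T)
    (hs : Summable fun n => ‖C n‖ * ((1 + r n) * Real.exp (-(Real.pi / 2) * r n * T))) :
    ∫ t₁ in Set.Ioi T, ∫ t₂ in Set.Ioi t₁, ∑' n, C n *
        ((eichlerKernel (x n) t₁ * eichlerKernel (y n) t₂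
          + eichlerKernel (x' n) t₁ * eichlerKernel (y' n) t₂ : ℝ) : ℂ)
      = ∑' n, C n * ((∫ t in Set.Ioi T, (eichlerKernel (x n) t * eichlerTail (y n) t
          + eichlerKernel (x' n) t * eichlerTail (y' n) t) : ℝ) : ℂ) := by
  have inner : ∀ t₁ ∈ Set.Ioi T, ∫ t₂ in Set.Ioi t₁, ∑' n, C n *
        ((eichlerKernel (x n) t₁ * eichlerKernel (y n) t₂
          + eichlerKernel (x' n) t₁ * eichlerKernel (y' n) t₂ : ℝ) : ℂ)
      = ∑' n, C n * ((eichlerKernel (x n) t₁ * eichlerTail (y n) t₁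
          + eichlerKernel (x' n) t₁ * eichlerTail (y' n) t₁ : ℝ) : ℂ) := fun t₁ ht => by
    have ht0 : 0 < t₁ := hT.trans ht
    have hi : ∀ x y : ℝ, IntegrableOn (fun t => eichlerKernel x t₁ * eichlerKernel y t)
      (Set.Ioi t₁) := fun x y => (integrableOn_eichlerKernel y ht0).const_mul _
    have hI : ∀ n, IntegrableOn (fun t₂ => C n *
        ((eichlerKernel (x n) t₁ * eichlerKernel (y n) t₂
          + eichlerKernel (x' n) t₁ * eichlerKernel (y' n) t₂ : ℝ) : ℂ)) (Set.Ioi t₁) := fun n =>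
      ((hi (x n) (y n)).add (hi (x' n) (y' n))).ofReal.const_mul (C n)
    rw [← (hasSum_integral_of_summable_integral_norm hI ?_).tsum_eq]
    · refine tsum_congr fun n => ?_
      rw [integral_const_mul]
      congr 1
      rw [integral_complex_ofReal, integral_add (hi _ _) (hi _ _), integral_const_mul,
        integral_const_mul, integral_eichlerKernel _ ht0, integral_eichlerKernel _ ht0]
    · refine Summable.of_nonneg_of_le (fun n => by positivity) (fun n => ?_)
        (hs.mul_left (2 * (2 / Real.sqrt T)))
      have h1 := integral_abs_kernel_mul_kernel_le (x n) (y n) hT (le_of_lt ht)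
      have h2 := integral_abs_kernel_mul_kernel_le (x' n) (y' n) hT (le_of_lt ht)
      rw [hr] at h1
      rw [hr'] at h2
      refine (integral_norm_const_mul_add_le (C n) (hi _ _) (hi _ _) h1 h2).trans (le_of_eq ?_)
      ring
  rw [setIntegral_congr_fun measurableSet_Ioi inner]
  have hi : ∀ x y : ℝ, IntegrableOn (fun t => eichlerKernel x t * eichlerTail y t) (Set.Ioi T) :=
    fun x y => integrableOn_eichlerKernel_mul_tail x y hT
  have hI : ∀ n, IntegrableOn (fun t => C n * ((eichlerKernel (x n) t * eichlerTail (y n) t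
      + eichlerKernel (x' n) t * eichlerTail (y' n) t : ℝ) : ℂ)) (Set.Ioi T) := fun n =>
    ((hi (x n) (y n)).add (hi (x' n) (y' n))).ofReal.const_mul (C n)
  rw [← (hasSum_integral_of_summable_integral_norm hI ?_).tsum_eq]
  · refine tsum_congr fun n => ?_
    rw [integral_const_mul]
    congr 1
    exact integral_complex_ofReal
  · refine Summable.of_nonneg_of_le (fun n => by positivity) (fun n => ?_) (hs.mul_left (2 * 4))
    have h1 := integral_abs_kernel_mul_tail_le (x n) (y n) hT
    have h2 := integral_abs_kernel_mul_tail_le (x' n) (y' n) hT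
    rw [hr] at h1
    rw [hr'] at h2
    refine (integral_norm_const_mul_add_le (C n) (hi _ _) (hi _ _) h1 h2).trans (le_of_eq ?_)
    ring

theorem setIntegral_Ioi_zero_comp_add (f : ℝ → ℂ) (a : ℝ) :
    ∫ s in Set.Ioi (0 : ℝ), f (a + s) = ∫ t in Set.Ioi a, f t := by
  have h := (measurePreserving_add_left volume a).setIntegral_preimage_emb
    (measurableEmbedding_addLeft a) f (Set.Ioi a)
  simpa using h

theorem summable_theta_bound (α : ℝ × ℝ) {v : ℝ} (hv : 0 < v) :
    Summable fun n : ℤ × ℤ => (1 + 4 * Qf (α.1 + n.1) (α.2 + n.2))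
      * Real.exp (-(Real.pi / 2) * (4 * Qf (α.1 + n.1) (α.2 + n.2)) * v) := by
  have hpi := Real.pi_pos
  have h1 := HurwitzKernelBounds.summable_f_int 0 α.1 (t := v / 8) (by positivity)
  have h2 := HurwitzKernelBounds.summable_f_int 0 α.2 (t := v / 8) (by positivity)
  have h := h1.mul_of_nonneg h2 (fun n => by simp only [HurwitzKernelBounds.f_int]; positivity)
    (fun n => by simp only [HurwitzKernelBounds.f_int]; positivity)
  set c := Real.pi / 2 * v with hc
  have hc0 : 0 < c := by positivity
  refine Summable.of_nonneg_of_le (fun n => ?_) (fun n => ?_) (h.mul_left (1 + 2 / c))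
  · have : 0 ≤ Qf (α.1 + n.1) (α.2 + n.2) := by
      rw [Qf]; nlinarith [sq_nonneg (2 * (α.1 + n.1) + (α.2 + n.2)), sq_nonneg (α.2 + n.2)]
    positivity
  · simp only [HurwitzKernelBounds.f_int, pow_zero, one_mul]
    set m₁ := α.1 + n.1 with hm₁
    set m₂ := α.2 + n.2 with hm₂
    rw [add_comm (n.1 : ℝ) α.1, add_comm (n.2 : ℝ) α.2, ← hm₁, ← hm₂, ← Real.exp_add]
    have hr : (m₁ ^ 2 + m₂ ^ 2) / 2 ≤ 4 * Qf m₁ m₂ := by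
      rw [Qf]; nlinarith [sq_nonneg (12 * m₁ + 7 * m₂), sq_nonneg m₁, sq_nonneg m₂]
    set r := 4 * Qf m₁ m₂ with hr_def
    have hr0 : 0 ≤ r := le_trans (by positivity) hr
    have h3 : 1 + r ≤ (1 + 2 / c) * Real.exp (c * r / 2) := by
      have h4 := Real.add_one_le_exp (c * r / 2)
      have h5 : (1 + 2 / c) * (c * r / 2 + 1) = 1 + r + (c * r / 2 + 2 / c) := by
        field_simp; ring
      have h6 : 0 ≤ c * r / 2 + 2 / c := by positivity
      have h7 : 0 ≤ 1 + 2 / c := by positivity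
      nlinarith [mul_le_mul_of_nonneg_left h4 h7]
    calc (1 + r) * Real.exp (-(Real.pi / 2) * r * v)
        ≤ ((1 + 2 / c) * Real.exp (c * r / 2)) * Real.exp (-(Real.pi / 2) * r * v) := by gcongr
      _ = (1 + 2 / c) * Real.exp (-(c * r / 2)) := by
          rw [mul_assoc, ← Real.exp_add, hc]; congr 2; ring
      _ ≤ _ := by
          gcongr
          rw [hc]
          nlinarith [mul_le_mul_of_nonneg_left hr hc0.le]

theorem ofReal_cpow_neg_half {t : ℝ} (ht : 0 < t) :
    (t : ℂ) ^ (-(1 : ℂ) / 2) = ((1 / Real.sqrt t : ℝ) : ℂ) := by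
  rw [show (-(1 : ℂ) / 2) = ((-(1 / 2) : ℝ) : ℂ) by push_cast; ring, ← Complex.ofReal_cpow ht.le,
    Real.rpow_neg ht.le, ← Real.sqrt_eq_rpow, one_div]

theorem abs_kernel_mul_kernel_le (x y : ℝ) {T t₁ t₂ : ℝ} (hT : 0 < T) (h1 : T ≤ t₁) (h2 : T ≤ t₂) :
    |eichlerKernel x t₁ * eichlerKernel y t₂|
      ≤ 1 / T * ((1 + (x ^ 2 + y ^ 2)) * Real.exp (-(Real.pi / 2) * (x ^ 2 + y ^ 2) * T)) := by
  have hs : Real.sqrt T * Real.sqrt T = T := Real.mul_self_sqrt hT.le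
  have hsT := Real.sqrt_pos.2 hT
  rw [abs_mul]
  calc _ ≤ (|x| / Real.sqrt T * Real.exp (-(Real.pi / 2) * x ^ 2 * T))
        * (|y| / Real.sqrt T * Real.exp (-(Real.pi / 2) * y ^ 2 * T)) :=
        mul_le_mul (abs_eichlerKernel_le hT h1) (abs_eichlerKernel_le hT h2) (abs_nonneg _)
          (by positivity)
    _ = 1 / T * ((|x| * |y|) * Real.exp (-(Real.pi / 2) * (x ^ 2 + y ^ 2) * T)) := by
        rw [show -(Real.pi / 2) * (x ^ 2 + y ^ 2) * T = -(Real.pi / 2) * x ^ 2 * T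
          + -(Real.pi / 2) * y ^ 2 * T by ring, Real.exp_add]
        rw [show 1 / T = 1 / Real.sqrt T * (1 / Real.sqrt T) by rw [← hs]; field_simp; simp]
        ring
    _ ≤ _ := by
        gcongr
        nlinarith [sq_nonneg (|x| - |y|), sq_abs x, sq_abs y, sq_nonneg x, sq_nonneg y]

theorem cexp_theta_eq (τ : ℂ) {A B q t₁ t₂ : ℝ} (h : A + B = 4 * q) :
    Complex.exp ((Real.pi * Complex.I / 2) * (A : ℂ) * (Complex.I * t₁ - τ)
        + (Real.pi * Complex.I / 2) * (B : ℂ) * (Complex.I * t₂ - τ))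
      = Complex.exp (-(2 * Real.pi * Complex.I * τ) * (q : ℝ))
        * ((Real.exp (-(Real.pi / 2) * A * t₁) * Real.exp (-(Real.pi / 2) * B * t₂) : ℝ) : ℂ) := by
  have hA : (A : ℂ) = 4 * q - B := by
    rw [eq_sub_iff_add_eq]; exact_mod_cast h
  push_cast
  rw [← Complex.exp_add, ← Complex.exp_add, hA]
  congr 1
  linear_combination (Real.pi / 2 * ((4 * q - B) * t₁ + B * t₂) : ℂ) * Complex.I_mul_I

theorem theta_term_eq (τ : ℂ) {A B q t₁ t₂ x y c : ℝ} (hA : A = x ^ 2) (hB : B = y ^ 2)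
    (h : A + B = 4 * q) (hc : Real.sqrt 3 * c = x * y) :
    (c : ℂ) * Complex.exp ((Real.pi * Complex.I / 2) * (A : ℂ) * (Complex.I * t₁ - τ)
        + (Real.pi * Complex.I / 2) * (B : ℂ) * (Complex.I * t₂ - τ))
        * ((1 / Real.sqrt t₁ : ℝ) : ℂ) * ((1 / Real.sqrt t₂ : ℝ) : ℂ)
      = ((1 / Real.sqrt 3 : ℝ) : ℂ) * Complex.exp (-(2 * Real.pi * Complex.I * τ) * (q : ℝ))
        * ((eichlerKernel x t₁ * eichlerKernel y t₂ : ℝ) : ℂ) := by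
  have h3 : Real.sqrt 3 ≠ 0 := (Real.sqrt_pos.2 (by norm_num)).ne'
  have hc' : c = 1 / Real.sqrt 3 * (x * y) := by rw [← hc]; field_simp
  rw [cexp_theta_eq τ h, hc', eichlerKernel, eichlerKernel, hA, hB]
  push_cast
  ring

theorem E1a_eq (α : ℝ × ℝ) (hα : ∀ n : ℤ × ℤ, α.1 + n.1 ≠ 0 ∨ α.2 + n.2 ≠ 0) (τ : ℂ)
    (hτ : 0 < τ.im) :
    E1a α τ = (1 / 2) * ∑' n : ℤ × ℤ,
      (M2 (Real.sqrt 3) (Real.sqrt (3 * τ.im) * (2 * (α.1 + n.1) + (α.2 + n.2)))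
          (Real.sqrt τ.im * (α.2 + n.2)) : ℂ) *
        Complex.exp (-(2 * Real.pi * Complex.I * τ) * (Qf (α.1 + n.1) (α.2 + n.2) : ℝ)) := by
  set v := τ.im with hv
  have h2v : 0 < 2 * v := by positivity
  have h3 : 0 < Real.sqrt 3 := Real.sqrt_pos.2 (by norm_num)
  have h33 : Real.sqrt 3 * Real.sqrt 3 = 3 := Real.mul_self_sqrt (by norm_num)
  have h32 : Real.sqrt 3 ^ 2 = 3 := Real.sq_sqrt (by norm_num)
  have h4 : Real.sqrt (1 + Real.sqrt 3 ^ 2) = 2 := by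
    rw [h32, show (1 + 3 : ℝ) = 2 ^ 2 by norm_num, Real.sqrt_sq zero_le_two]
  set C : ℤ × ℤ → ℂ := fun n => ((1 / Real.sqrt 3 : ℝ) : ℂ) *
    Complex.exp (-(2 * Real.pi * Complex.I * τ) * (Qf (α.1 + n.1) (α.2 + n.2) : ℝ)) with hC
  set x : ℤ × ℤ → ℝ := fun n => Real.sqrt 3 * (2 * (α.1 + n.1) + (α.2 + n.2)) with hx
  set y : ℤ × ℤ → ℝ := fun n => α.2 + n.2 with hy
  set x' : ℤ × ℤ → ℝ := fun n => 3 * (α.1 + n.1) + 2 * (α.2 + n.2) with hx'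
  set y' : ℤ × ℤ → ℝ := fun n => Real.sqrt 3 * (α.1 + n.1) with hy'
  set r : ℤ × ℤ → ℝ := fun n => 4 * Qf (α.1 + n.1) (α.2 + n.2) with hrdef
  have hr : ∀ n, x n ^ 2 + y n ^ 2 = r n := fun n => by
    simp only [hx, hy, hrdef, Qf]; rw [mul_pow, h32]; ring
  have hr' : ∀ n, x' n ^ 2 + y' n ^ 2 = r n := fun n => by
    simp only [hx', hy', hrdef, Qf]; rw [mul_pow, h32]; ring
  have hCn : ∀ n, ‖C n‖ = 1 / Real.sqrt 3 * Real.exp (Real.pi / 2 * r n * v) := fun n => by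
    simp only [hC, hrdef]
    rw [norm_mul, Complex.norm_real, Real.norm_of_nonneg (by positivity), Complex.norm_exp]
    congr 2
    simp [hv]; ring
  have hs : Summable fun n => ‖C n‖ * ((1 + r n) * Real.exp (-(Real.pi / 2) * r n * (2 * v))) := by
    refine ((summable_theta_bound α hτ).mul_left (1 / Real.sqrt 3)).congr fun n => ?_
    rw [hCn]
    have : Real.exp (-(Real.pi / 2) * r n * v) = Real.exp (Real.pi / 2 * r n * v)
        * Real.exp (-(Real.pi / 2) * r n * (2 * v)) := by
      rw [← Real.exp_add]; congr 1; ring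
    simp only [hrdef] at this ⊢
    rw [this]; ring
  have hsum : ∀ (x y : ℤ × ℤ → ℝ), (∀ n, x n ^ 2 + y n ^ 2 = r n) → ∀ t₁ t₂, 2 * v ≤ t₁ →
      2 * v ≤ t₂ → Summable fun n => C n * ((eichlerKernel (x n) t₁ * eichlerKernel (y n) t₂ : ℝ) : ℂ) := by
    intro x y hxy t₁ t₂ ht₁ ht₂
    refine Summable.of_norm_bounded (hs.mul_left (1 / (2 * v))) fun n => ?_
    rw [norm_mul, Complex.norm_real, Real.norm_eq_abs, mul_left_comm]
    have := abs_kernel_mul_kernel_le (x n) (y n) h2v ht₁ ht₂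
    rw [hxy] at this
    gcongr
  have hv1 : ∀ s : ℝ, vray τ s = Complex.I * ((2 * v + s : ℝ) : ℂ) - τ := fun s => by
    apply Complex.ext <;> simp [vray, hv]; ring
  have hpt : ∀ s₁ ∈ Set.Ioi (0 : ℝ), ∀ s₂ ∈ Set.Ioi (0 : ℝ),
      (theta1 α (vray τ s₁) (vray τ s₁ + Complex.I * s₂)
          + theta2 α (vray τ s₁) (vray τ s₁ + Complex.I * s₂)) *
        (-Complex.I * (vray τ s₁ + τ)) ^ (-(1 : ℂ) / 2) *
        (-Complex.I * (vray τ s₁ + Complex.I * s₂ + τ)) ^ (-(1 : ℂ) / 2)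
      = ∑' n, C n * ((eichlerKernel (x n) (2 * v + s₁) * eichlerKernel (y n) (2 * v + s₁ + s₂)
          + eichlerKernel (x' n) (2 * v + s₁) * eichlerKernel (y' n) (2 * v + s₁ + s₂) : ℝ) : ℂ) := by
    intro s₁ hs₁ s₂ hs₂
    have hs₁' : 0 < s₁ := hs₁
    have hs₂' : 0 < s₂ := hs₂
    have ht₁ : 2 * v ≤ 2 * v + s₁ := by linarith
    have ht₂ : 2 * v ≤ 2 * v + s₁ + s₂ := by linarith
    have e1 : vray τ s₁ + Complex.I * s₂ = Complex.I * ((2 * v + s₁ + s₂ : ℝ) : ℂ) - τ := by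
      rw [hv1]; push_cast; ring
    rw [e1, hv1]
    have e2 : ∀ t : ℝ, -Complex.I * (Complex.I * (t : ℂ) - τ + τ) = (t : ℂ) := fun t => by
      linear_combination -(t : ℂ) * Complex.I_mul_I
    rw [e2, e2, ofReal_cpow_neg_half (h2v.trans_le ht₁), ofReal_cpow_neg_half (h2v.trans_le ht₂)]
    generalize 2 * v + s₁ + s₂ = t₂ at ht₂ ⊢
    generalize 2 * v + s₁ = t₁ at ht₁ ⊢
    simp only [Complex.ofReal_add (_ * _) (_ * _), mul_add]
    rw [(hsum x y hr t₁ t₂ ht₁ ht₂).tsum_add (hsum x' y' hr' t₁ t₂ ht₁ ht₂), add_mul, add_mul]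
    congr 1
    · rw [theta1, ← tsum_mul_right, ← tsum_mul_right]
      refine tsum_congr fun n => ?_
      rw [← theta_term_eq τ (A := 3 * (2 * (α.1 + n.1) + (α.2 + n.2)) ^ 2)
        (B := (α.2 + n.2) ^ 2) (c := (2 * (α.1 + n.1) + (α.2 + n.2)) * (α.2 + n.2))
        (by simp only [hx]; rw [mul_pow, h32]) rfl (by rw [Qf]; ring)
        (by simp only [hx]; ring)]
      push_cast
      ring_nf
    · rw [theta2, ← tsum_mul_right, ← tsum_mul_right]
      refine tsum_congr fun n => ?_
      rw [← theta_term_eq τ (A := (3 * (α.1 + n.1) + 2 * (α.2 + n.2)) ^ 2)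
        (B := 3 * (α.1 + n.1) ^ 2) (c := (3 * (α.1 + n.1) + 2 * (α.2 + n.2)) * (α.1 + n.1))
        rfl (by simp only [hy']; rw [mul_pow, h32]) (by rw [Qf]; ring)
        (by simp only [hy']; ring)]
      push_cast
      ring_nf
  have hint : ∀ n, ∫ t in Set.Ioi (2 * v), (eichlerKernel (x n) t * eichlerTail (y n) t
        + eichlerKernel (x' n) t * eichlerTail (y' n) t)
      = 2 * M2 (Real.sqrt 3) (Real.sqrt (3 * v) * (2 * (α.1 + n.1) + (α.2 + n.2)))
          (Real.sqrt v * (α.2 + n.2)) := fun n => by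
    have hne : x n ≠ 0 ∨ y n ≠ 0 := by
      by_contra! h0
      have h2 : α.2 + n.2 = 0 := h0.2
      have h1 : 2 * (α.1 + n.1) + (α.2 + n.2) = 0 := (mul_eq_zero.1 h0.1).resolve_left h3.ne'
      rcases hα n with h | h
      · exact h (by linarith)
      · exact h h2
    have h := integral_eichlerKernel_mul_tail (Real.sqrt 3) hne hτ
    have e1 : (y n + Real.sqrt 3 * x n) / Real.sqrt (1 + Real.sqrt 3 ^ 2) = x' n := by
      rw [h4]; simp only [hx, hy, hx']; linear_combination (2 * (α.1 + n.1) + (α.2 + n.2)) / 2 * h33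
    have e2 : (x n - Real.sqrt 3 * y n) / Real.sqrt (1 + Real.sqrt 3 ^ 2) = y' n := by
      rw [h4]; simp only [hx, hy, hy']; ring
    rw [e1, e2] at h
    rw [h]
    simp only [hx, hy]
    rw [Real.sqrt_mul (by norm_num : (0 : ℝ) ≤ 3)]
    congr 2
    ring
  have hmain := integral_integral_tsum_eichlerKernel C x y x' y' r hr hr' h2v hs
  rw [E1a, setIntegral_congr_fun measurableSet_Ioi fun s₁ hs₁ =>
    setIntegral_congr_fun measurableSet_Ioi fun s₂ hs₂ => hpt s₁ hs₁ s₂ hs₂]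
  have hshift : ∀ s₁ : ℝ, ∫ s₂ in Set.Ioi (0 : ℝ), ∑' n, C n *
        ((eichlerKernel (x n) (2 * v + s₁) * eichlerKernel (y n) (2 * v + s₁ + s₂)
          + eichlerKernel (x' n) (2 * v + s₁) * eichlerKernel (y' n) (2 * v + s₁ + s₂) : ℝ) : ℂ)
      = ∫ t₂ in Set.Ioi (2 * v + s₁), ∑' n, C n *
        ((eichlerKernel (x n) (2 * v + s₁) * eichlerKernel (y n) t₂
          + eichlerKernel (x' n) (2 * v + s₁) * eichlerKernel (y' n) t₂ : ℝ) : ℂ) := fun s₁ =>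
    setIntegral_Ioi_zero_comp_add (fun t₂ => ∑' n, C n *
        ((eichlerKernel (x n) (2 * v + s₁) * eichlerKernel (y n) t₂
          + eichlerKernel (x' n) (2 * v + s₁) * eichlerKernel (y' n) t₂ : ℝ) : ℂ)) (2 * v + s₁)
  simp_rw [hshift]
  rw [setIntegral_Ioi_zero_comp_add (fun t₁ => ∫ t₂ in Set.Ioi t₁, ∑' n, C n *
        ((eichlerKernel (x n) t₁ * eichlerKernel (y n) t₂
          + eichlerKernel (x' n) t₁ * eichlerKernel (y' n) t₂ : ℝ) : ℂ)) (2 * v), hmain,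
    Complex.I_mul_I, ← tsum_mul_left, ← tsum_mul_left, ← tsum_mul_left]
  refine tsum_congr fun n => ?_
  rw [hint]
  simp only [hC]
  have h3c : (Real.sqrt 3 : ℂ) ≠ 0 := by exact_mod_cast h3.ne'
  push_cast
  field_simp
  ring

theorem one_sub_inv_add_int_ne_zero {p : ℕ} (hp : 2 ≤ p) (m : ℤ) :
    1 - 1 / (p : ℝ) + m ≠ 0 := by
  intro h
  have hp0 : (p : ℝ) ≠ 0 := by positivity
  have h1 : (p : ℝ) * (1 + m) = 1 := by
    field_simp at h
    linarith
  have h2 : (p : ℤ) * (1 + m) = 1 := by exact_mod_cast h1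
  have h3 : (p : ℤ) ∣ 1 := ⟨_, h2.symm⟩
  have := Int.le_of_dvd one_pos h3
  omega

/-- Lemma 6.1 of the paper: the double Eichler integrals combine to a nonholomorphic
theta series built from `M₂`. -/
theorem E1_theta_series (p : ℕ) (hp : 2 ≤ p) (τ : ℂ) (hτ : 0 < τ.im) :
    ∑ i : Fin 3, (epsStar i : ℂ) * E1a (Sstar p i) τ =
      (1 / 2) * ∑ i : Fin 3, (epsStar i : ℂ) *
        ∑' n : ℤ × ℤ,
          (M2 (Real.sqrt 3)
              (Real.sqrt (3 * τ.im) * (2 * ((Sstar p i).1 + n.1) + ((Sstar p i).2 + n.2)))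
              (Real.sqrt τ.im * ((Sstar p i).2 + n.2)) : ℂ) *
            Complex.exp (-(2 * Real.pi * Complex.I * τ) *
              (Qf ((Sstar p i).1 + n.1) ((Sstar p i).2 + n.2) : ℝ)) := by
  have hne : ∀ (i : Fin 3) (n : ℤ × ℤ), (Sstar p i).1 + n.1 ≠ 0 ∨ (Sstar p i).2 + n.2 ≠ 0 := by
    intro i n
    fin_cases i
    · exact Or.inl (one_sub_inv_add_int_ne_zero hp n.1)
    · exact Or.inr (one_sub_inv_add_int_ne_zero hp n.2)
    · exact Or.inr (one_sub_inv_add_int_ne_zero hp n.2)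
  rw [Finset.mul_sum]
  refine Finset.sum_congr rfl fun i _ => ?_
  rw [E1a_eq (Sstar p i) (hne i) τ hτ]
  ring

end
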